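/- Assume n is even. The function φ₁(y) = x_{−1}(y) · x₁(y)^{−n/2} satisfies (∂²φ₁)(y) = n · x₁(y)^{−(n+2)/2} at every point y of the open set Ω = {y ∈ ℝ^{n+2} : (y_0, y_1) ≠ (0,0)}. Consequently ∂²φ₁ is not identically zero on Ω, while ∂²(∂²φ₁) = 0 on Ω; i.e. the scalar-state generator φ₁ of the Gupta–Bleuler triplet satisfies the dipole equation (∂²)²φ₁ = 0 but not the Laplace equation. -/

import Mathlib

open Finset

/-- The diagonal metric of signature `(2,n)` on `ℝ^{n+2}`. -/
def eta (n : ℕ) (a : Fin (n + 2)) : ℝ := if (a : ℕ) < 2 then 1 else -1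

/-- Partial derivative in the `a`-th coordinate direction. -/
noncomputable def pd (n : ℕ) (a : Fin (n + 2)) (f : (Fin (n + 2) → ℝ) → ℂ) :
    (Fin (n + 2) → ℝ) → ℂ :=
  fun y => fderiv ℝ f y (Pi.single a 1)

/-- The `η`-d'Alembertian `∂²f = Σ_a η_{aa} ∂_a ∂_a f`. -/
noncomputable def box (n : ℕ) (f : (Fin (n + 2) → ℝ) → ℂ) :
    (Fin (n + 2) → ℝ) → ℂ :=
  fun y => ∑ a, eta n a • pd n a (pd n a f) y

/-- The complex coordinate `x₁(y) = (i/√2)(y₀ + i y₁)`. -/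
noncomputable def x1 (n : ℕ) (y : Fin (n + 2) → ℝ) : ℂ :=
  (Complex.I / (Real.sqrt 2 : ℂ)) * ((y 0 : ℂ) + Complex.I * (y 1 : ℂ))

/-- The complex coordinate `x₋₁(y) = (i/√2)(y₀ - i y₁)`. -/
noncomputable def xm1 (n : ℕ) (y : Fin (n + 2) → ℝ) : ℂ :=
  (Complex.I / (Real.sqrt 2 : ℂ)) * ((y 0 : ℂ) - Complex.I * (y 1 : ℂ))

/-- The scalar-state generator `φ₁(y) = x₋₁(y) · x₁(y)^{-n/2}` of the
Gupta–Bleuler triplet (`n` even). -/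
noncomputable def phi1 (n : ℕ) : (Fin (n + 2) → ℝ) → ℂ :=
  fun y => xm1 n y * x1 n y ^ (-((n / 2 : ℕ) : ℤ))

lemma x1_ne_zero {n : ℕ} {y : Fin (n + 2) → ℝ} (hy : (y 0, y 1) ≠ ((0 : ℝ), (0 : ℝ))) :
    x1 n y ≠ 0 := by
  have h2 : (Real.sqrt 2 : ℂ) ≠ 0 := by simp
  refine mul_ne_zero (div_ne_zero Complex.I_ne_zero h2) fun h => hy ?_
  have hre := congrArg Complex.re h
  have him := congrArg Complex.im h
  simp at hre him
  simp [hre, him]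

/-- `x1` as a continuous `ℝ`-linear map. -/
noncomputable def x1L (n : ℕ) : (Fin (n + 2) → ℝ) →L[ℝ] ℂ :=
  LinearMap.toContinuousLinearMap
    { toFun := x1 n
      map_add' := fun y z => by simp only [x1, Pi.add_apply]; push_cast; ring
      map_smul' := fun r y => by
        simp only [x1, Pi.smul_apply, smul_eq_mul, Complex.real_smul, RingHom.id_apply]
        push_cast; ring }

/-- `xm1` as a continuous `ℝ`-linear map. -/
noncomputable def xm1L (n : ℕ) : (Fin (n + 2) → ℝ) →L[ℝ] ℂ :=
  LinearMap.toContinuousLinearMap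
    { toFun := xm1 n
      map_add' := fun y z => by simp only [xm1, Pi.add_apply]; push_cast; ring
      map_smul' := fun r y => by
        simp only [xm1, Pi.smul_apply, smul_eq_mul, Complex.real_smul, RingHom.id_apply]
        push_cast; ring }

lemma hasFDerivAt_x1 (n : ℕ) (y : Fin (n + 2) → ℝ) : HasFDerivAt (x1 n) (x1L n) y :=
  (x1L n).hasFDerivAt

lemma hasFDerivAt_xm1 (n : ℕ) (y : Fin (n + 2) → ℝ) : HasFDerivAt (xm1 n) (xm1L n) y :=
  (xm1L n).hasFDerivAt

lemma eventually_x1_ne_zero {n : ℕ} {y : Fin (n + 2) → ℝ} (hy : x1 n y ≠ 0) :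
    ∀ᶠ z in nhds y, x1 n z ≠ 0 :=
  (hasFDerivAt_x1 n y).continuousAt.eventually_ne hy

/-- The derivative of `(A + B x₋₁) x₁^p`. -/
lemma hasFDerivAt_affine_mul_zpow (n : ℕ) (A B : ℂ) (p : ℤ) {y : Fin (n + 2) → ℝ}
    (hy : x1 n y ≠ 0) :
    HasFDerivAt (fun z => (A + B * xm1 n z) * x1 n z ^ p)
      ((A + B * xm1 n y) • ((p * x1 n y ^ (p - 1)) • x1L n) + x1 n y ^ p • (B • xm1L n)) y :=
  (((hasFDerivAt_xm1 n y).const_mul B).const_add A).mul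
    ((hasDerivAt_zpow p _ (Or.inl hy)).comp_hasFDerivAt y (hasFDerivAt_x1 n y))

lemma pd_affine_mul_zpow (n : ℕ) (a : Fin (n + 2)) (A B : ℂ) (p : ℤ) {y : Fin (n + 2) → ℝ}
    (hy : x1 n y ≠ 0) :
    pd n a (fun z => (A + B * xm1 n z) * x1 n z ^ p) y =
      p * x1 n (Pi.single a 1) * ((A + B * xm1 n y) * x1 n y ^ (p - 1)) +
        B * xm1 n (Pi.single a 1) * ((1 + 0 * xm1 n y) * x1 n y ^ p) := by
  rw [pd, (hasFDerivAt_affine_mul_zpow n A B p hy).fderiv]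
  simp only [x1L, xm1L, add_apply, smul_apply,
    LinearMap.coe_toContinuousLinearMap', LinearMap.coe_mk, AddHom.coe_mk, smul_eq_mul]
  ring

lemma pd_pd_affine_mul_zpow (n : ℕ) (a : Fin (n + 2)) (A B : ℂ) (p : ℤ) {y : Fin (n + 2) → ℝ}
    (hy : x1 n y ≠ 0) :
    pd n a (pd n a (fun z => (A + B * xm1 n z) * x1 n z ^ p)) y =
      p * (p - 1) * (A + B * xm1 n y) * x1 n y ^ (p - 2) * x1 n (Pi.single a 1) ^ 2 +
        2 * p * B * x1 n y ^ (p - 1) * (x1 n (Pi.single a 1) * xm1 n (Pi.single a 1)) := by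
  have hev := (eventually_x1_ne_zero hy).mono fun z hz => pd_affine_mul_zpow n a A B p hz
  have hd := ((hasFDerivAt_affine_mul_zpow n A B (p - 1) hy).const_mul
    (p * x1 n (Pi.single a 1))).add ((hasFDerivAt_affine_mul_zpow n 1 0 p hy).const_mul
    (B * xm1 n (Pi.single a 1)))
  rw [pd, (hd.congr_of_eventuallyEq hev).fderiv]
  simp only [x1L, xm1L, add_apply, smul_apply,
    LinearMap.coe_toContinuousLinearMap', LinearMap.coe_mk, AddHom.coe_mk, smul_eq_mul]
  rw [show p - 1 - 1 = p - 2 by ring]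
  push_cast
  ring

lemma I_div_sqrt_two_sq : (Complex.I / (Real.sqrt 2 : ℂ)) ^ 2 = -1 / 2 := by
  rw [div_pow, Complex.I_sq, ← Complex.ofReal_pow, Real.sq_sqrt zero_le_two, Complex.ofReal_ofNat]

lemma sum_eta_x1_sq (n : ℕ) : ∑ a, (eta n a : ℂ) * x1 n (Pi.single a 1) ^ 2 = 0 := by
  rw [Fin.sum_univ_succ, Fin.sum_univ_succ, Finset.sum_eq_zero]
  · simp [eta, x1, mul_pow]
  · intro i _
    have h1 : (1 : Fin (n + 2)) ≠ i.succ.succ := by simp [Fin.ext_iff]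
    simp [x1, Pi.single_eq_of_ne h1]

lemma sum_eta_x1_mul_xm1 (n : ℕ) :
    ∑ a, (eta n a : ℂ) * (x1 n (Pi.single a 1) * xm1 n (Pi.single a 1)) = -1 := by
  rw [Fin.sum_univ_succ, Fin.sum_univ_succ, Finset.sum_eq_zero]
  · simp [eta, x1, xm1]
    linear_combination (1 - Complex.I ^ 2) * I_div_sqrt_two_sq + (1 / 2) * Complex.I_sq
  · intro i _
    have h1 : (1 : Fin (n + 2)) ≠ i.succ.succ := by simp [Fin.ext_iff]
    simp [x1, Pi.single_eq_of_ne h1]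

lemma box_affine_mul_zpow (n : ℕ) (A B : ℂ) (p : ℤ) {y : Fin (n + 2) → ℝ}
    (hy : x1 n y ≠ 0) :
    box n (fun z => (A + B * xm1 n z) * x1 n z ^ p) y = -2 * p * B * x1 n y ^ (p - 1) := by
  simp only [_root_.box, pd_pd_affine_mul_zpow n _ A B p hy, Complex.real_smul]
  calc
    _ = p * (p - 1) * (A + B * xm1 n y) * x1 n y ^ (p - 2) *
          ∑ a, (eta n a : ℂ) * x1 n (Pi.single a 1) ^ 2 +
        2 * p * B * x1 n y ^ (p - 1) *
          ∑ a, (eta n a : ℂ) * (x1 n (Pi.single a 1) * xm1 n (Pi.single a 1)) := by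
      rw [Finset.mul_sum, Finset.mul_sum, ← Finset.sum_add_distrib]
      exact Finset.sum_congr rfl fun a _ => by ring
    _ = -2 * p * B * x1 n y ^ (p - 1) := by
      rw [sum_eta_x1_sq, sum_eta_x1_mul_xm1]
      ring

lemma box_congr {n : ℕ} {f g : (Fin (n + 2) → ℝ) → ℂ} {y : Fin (n + 2) → ℝ}
    (h : f =ᶠ[nhds y] g) : box n f y = box n g y := by
  refine Finset.sum_congr rfl fun a _ => ?_
  have h' : pd n a f =ᶠ[nhds y] pd n a g :=
    h.fderiv.mono fun z hz => DFunLike.congr_fun hz (Pi.single a 1)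
  rw [pd, pd, h'.fderiv_eq]

lemma box_phi1 {n : ℕ} (hn : Even n) {y : Fin (n + 2) → ℝ} (hy : x1 n y ≠ 0) :
    box n (phi1 n) y = (n : ℂ) * x1 n y ^ (-((n / 2 : ℕ) : ℤ) - 1) := by
  have h := box_affine_mul_zpow n 0 1 (-((n / 2 : ℕ) : ℤ)) hy
  simp only [zero_add, one_mul] at h
  have h2 : (2 : ℂ) * ((n / 2 : ℕ) : ℂ) = n := by exact_mod_cast Nat.two_mul_div_two_of_even hn
  refine h.trans ?_
  rw [← h2, Int.cast_neg, Int.cast_natCast]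
  ring

/-- For `n` even, the scalar-state generator `φ₁ = x₋₁ · x₁^{-n/2}` satisfies
`∂²φ₁ = n · x₁^{-(n+2)/2}` on the open set `(y₀,y₁) ≠ (0,0)`; consequently
`∂²φ₁` is not identically zero there, while `∂²(∂²φ₁) = 0` there: `φ₁`
satisfies the dipole equation `(∂²)²φ₁ = 0` but not the Laplace equation. -/
theorem phi1_dipole (n : ℕ) (hn : 2 ≤ n) (hneven : Even n) :
    (∀ y : Fin (n + 2) → ℝ, (y 0, y 1) ≠ ((0 : ℝ), (0 : ℝ)) →
        box n (phi1 n) y = (n : ℂ) * x1 n y ^ (-((n / 2 : ℕ) : ℤ) - 1)) ∧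
    ¬ (∀ y : Fin (n + 2) → ℝ, (y 0, y 1) ≠ ((0 : ℝ), (0 : ℝ)) →
        box n (phi1 n) y = 0) ∧
    (∀ y : Fin (n + 2) → ℝ, (y 0, y 1) ≠ ((0 : ℝ), (0 : ℝ)) →
        box n (box n (phi1 n)) y = 0) := by
  refine ⟨fun y hy => box_phi1 hneven (x1_ne_zero hy), fun h => ?_, fun y hy => ?_⟩
  · have hy : ((1 : Fin (n + 2) → ℝ) 0, (1 : Fin (n + 2) → ℝ) 1) ≠ ((0 : ℝ), (0 : ℝ)) := by
      simp
    have h0 := h 1 hy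
    rw [box_phi1 hneven (x1_ne_zero hy)] at h0
    exact mul_ne_zero (Nat.cast_ne_zero.mpr (by omega)) (zpow_ne_zero _ (x1_ne_zero hy)) h0
  · have hx := x1_ne_zero hy
    have hev : box n (phi1 n) =ᶠ[nhds y]
        fun z => ((n : ℂ) + 0 * xm1 n z) * x1 n z ^ (-((n / 2 : ℕ) : ℤ) - 1) :=
      (eventually_x1_ne_zero hx).mono fun z hz => by simpa using box_phi1 hneven hz
    rw [box_congr hev, box_affine_mul_zpow n _ _ _ hx]
    simp
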